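/- Let F be a field, q ∈ F with q ≠ 0, and f, g ∈ F[h] with deg f > 1 and g ≠ 0. For λ ∈ F*, let φ_λ be the automorphism of H_q(f,g) with φ_λ(x) = λx, φ_λ(y) = λ^{-1}y, φ_λ(h) = h. Then the subgroup {φ ∈ Aut(H_q(f,g)) : φ(h) = h} equals {φ_λ : λ ∈ F*}, is isomorphic to the multiplicative group F*, and is contained in the center of Aut(H_q(f,g)). Moreover Aut(H_q(f,g)) is the internal direct product of this subgroup with the subgroup {φ ∈ Aut(H_q(f,g)) : φ(x) = x}. -/

import Mathlib

open Polynomial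

/-- The three generators `x`, `y`, `h` of a quantum generalized Heisenberg algebra. -/
inductive QGHAGen : Type
  | x : QGHAGen
  | y : QGHAGen
  | h : QGHAGen

/-- The defining relations of the quantum generalized Heisenberg algebra `H_q(f,g)`:
`h*x = x*f(h)`, `y*h = f(h)*y`, and `y*x - q*(x*y) = g(h)`. -/
inductive QGHARel (F : Type*) [Field F] (q : F) (f g : F[X]) :
    FreeAlgebra F QGHAGen → FreeAlgebra F QGHAGen → Prop
  | hx : QGHARel F q f g
      (FreeAlgebra.ι F QGHAGen.h * FreeAlgebra.ι F QGHAGen.x)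
      (FreeAlgebra.ι F QGHAGen.x * aeval (FreeAlgebra.ι F QGHAGen.h) f)
  | yh : QGHARel F q f g
      (FreeAlgebra.ι F QGHAGen.y * FreeAlgebra.ι F QGHAGen.h)
      (aeval (FreeAlgebra.ι F QGHAGen.h) f * FreeAlgebra.ι F QGHAGen.y)
  | yx : QGHARel F q f g
      (FreeAlgebra.ι F QGHAGen.y * FreeAlgebra.ι F QGHAGen.x)
      (q • (FreeAlgebra.ι F QGHAGen.x * FreeAlgebra.ι F QGHAGen.y)
        + aeval (FreeAlgebra.ι F QGHAGen.h) g)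

/-- The quantum generalized Heisenberg algebra `H_q(f,g)`. -/
def QGHA (F : Type*) [Field F] (q : F) (f g : F[X]) : Type _ :=
  RingQuot (QGHARel F q f g)

namespace QGHA

variable {F : Type*} [Field F] (q : F) (f g : F[X])

instance : Ring (QGHA F q f g) :=
  inferInstanceAs (Ring (RingQuot (QGHARel F q f g)))

instance : Algebra F (QGHA F q f g) :=
  inferInstanceAs (Algebra F (RingQuot (QGHARel F q f g)))

/-- The generator `x` of `H_q(f,g)`. -/
def x : QGHA F q f g :=
  RingQuot.mkAlgHom F (QGHARel F q f g) (FreeAlgebra.ι F QGHAGen.x)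

/-- The generator `y` of `H_q(f,g)`. -/
def y : QGHA F q f g :=
  RingQuot.mkAlgHom F (QGHARel F q f g) (FreeAlgebra.ι F QGHAGen.y)

/-- The generator `h` of `H_q(f,g)`. -/
def h : QGHA F q f g :=
  RingQuot.mkAlgHom F (QGHARel F q f g) (FreeAlgebra.ι F QGHAGen.h)

end QGHA


namespace QGHA

variable {F : Type*} [Field F] {q : F} {f g : F[X]}

theorem h_mul_x : h q f g * x q f g = x q f g * aeval (h q f g) f := by
  have := RingQuot.mkAlgHom_rel F (QGHARel.hx (q := q) (f := f) (g := g))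
  rw [map_mul, map_mul, ← aeval_algHom_apply] at this
  exact this

theorem y_mul_h : y q f g * h q f g = aeval (h q f g) f * y q f g := by
  have := RingQuot.mkAlgHom_rel F (QGHARel.yh (q := q) (f := f) (g := g))
  rw [map_mul, map_mul, ← aeval_algHom_apply] at this
  exact this

theorem y_mul_x :
    y q f g * x q f g = q • (x q f g * y q f g) + aeval (h q f g) g := by
  have := RingQuot.mkAlgHom_rel F (QGHARel.yx (q := q) (f := f) (g := g))
  rw [map_mul, map_add, map_smul, map_mul, ← aeval_algHom_apply] at this
  exact this

/-- An algebra map out of the free algebra, given by the images of the three generators. -/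
def freeLift {B : Type*} [Semiring B] [Algebra F B] (a b c : B) :
    FreeAlgebra F QGHAGen →ₐ[F] B :=
  FreeAlgebra.lift F fun
    | .x => a
    | .y => b
    | .h => c

/-- The universal property of `H_q(f,g)`. -/
def lift {B : Type*} [Ring B] [Algebra F B] (a b c : B) (hx : c * a = a * aeval c f)
    (yh : b * c = aeval c f * b) (yx : b * a = q • (a * b) + aeval c g) :
    QGHA F q f g →ₐ[F] B :=
  RingQuot.liftAlgHom F ⟨freeLift a b c, by
    rintro _ _ (_ | _ | _)
    · simpa [freeLift, ← aeval_algHom_apply] using hx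
    · simpa [freeLift, ← aeval_algHom_apply] using yh
    · simpa [freeLift, ← aeval_algHom_apply] using yx⟩

section lift

variable {B : Type*} [Ring B] [Algebra F B] {a b c : B} (hx : c * a = a * aeval c f)
    (yh : b * c = aeval c f * b) (yx : b * a = q • (a * b) + aeval c g)

@[simp]
theorem lift_x : lift a b c hx yh yx (x q f g) = a :=
  (RingQuot.liftAlgHom_mkAlgHom_apply F _ _ _).trans (by simp [freeLift])

@[simp]
theorem lift_y : lift a b c hx yh yx (y q f g) = b :=
  (RingQuot.liftAlgHom_mkAlgHom_apply F _ _ _).trans (by simp [freeLift])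

@[simp]
theorem lift_h : lift a b c hx yh yx (h q f g) = c :=
  (RingQuot.liftAlgHom_mkAlgHom_apply F _ _ _).trans (by simp [freeLift])

end lift

@[elab_as_elim]
theorem induction {C : QGHA F q f g → Prop} (algebraMap : ∀ r, C (algebraMap F _ r))
    (x : C (x q f g)) (y : C (y q f g)) (h : C (h q f g))
    (mul : ∀ a b, C a → C b → C (a * b)) (add : ∀ a b, C a → C b → C (a + b))
    (a : QGHA F q f g) : C a := by
  obtain ⟨a, rfl⟩ := RingQuot.mkAlgHom_surjective F (QGHARel F q f g) a
  induction a using FreeAlgebra.induction with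
  | grade0 r => exact (AlgHom.commutes (RingQuot.mkAlgHom F (QGHARel F q f g)) r) ▸ algebraMap r
  | grade1 i =>
    cases i
    · exact x
    · exact y
    · exact h
  | mul a b ha hb => exact (map_mul (RingQuot.mkAlgHom F (QGHARel F q f g)) a b) ▸ mul _ _ ha hb
  | add a b ha hb => exact (map_add (RingQuot.mkAlgHom F (QGHARel F q f g)) a b) ▸ add _ _ ha hb

theorem algEquiv_ext {φ ψ : QGHA F q f g ≃ₐ[F] QGHA F q f g}
    (hx : φ (x q f g) = ψ (x q f g)) (hy : φ (y q f g) = ψ (y q f g))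
    (hh : φ (h q f g) = ψ (h q f g)) : φ = ψ := by
  ext a
  induction a using induction with
  | algebraMap r => simp
  | x => exact hx
  | y => exact hy
  | h => exact hh
  | mul a b ha hb => rw [map_mul, map_mul, ha, hb]
  | add a b ha hb => rw [map_add, map_add, ha, hb]

/-! ### Normal forms -/

/-- The monomial `x ^ i * p(h) * y ^ k`. -/
noncomputable def mon (q : F) (f g : F[X]) (i k : ℕ) : F[X] →ₗ[F] QGHA F q f g :=
  LinearMap.mulLeft F (x q f g ^ i) ∘ₗ LinearMap.mulRight F (y q f g ^ k) ∘ₗ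
    (aeval (h q f g)).toLinearMap

theorem mon_apply (i k : ℕ) (p : F[X]) :
    mon q f g i k p = x q f g ^ i * aeval (h q f g) p * y q f g ^ k := by
  simp [mon, mul_assoc]

/-- The `i`-fold iterate of `f` under composition. -/
noncomputable def iter (f : F[X]) : ℕ → F[X]
  | 0 => X
  | i + 1 => f.comp (iter f i)

theorem iter_comp (i : ℕ) : (iter f i).comp f = iter f (i + 1) := by
  induction i with
  | zero => simp [iter]
  | succ i ih => rw [iter, comp_assoc, ih, ← iter]

/-- The polynomials `s i` with `y * x ^ i = q ^ i • (x ^ i * y) + x ^ (i - 1) * s i (h)`. -/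
noncomputable def corr (q : F) (f g : F[X]) : ℕ → F[X]
  | 0 => 0
  | i + 1 => q • corr q f g i + g.comp (iter f i)

theorem aeval_h_mul_x (p : F[X]) :
    aeval (h q f g) p * x q f g = x q f g * aeval (h q f g) (p.comp f) := by
  induction p using Polynomial.induction_on' with
  | add p r hp hr => simp [add_mul, mul_add, hp, hr]
  | monomial n c =>
    simp only [← C_mul_X_pow_eq_monomial, map_mul, aeval_C, map_pow, aeval_X, mul_comp, C_comp,
      X_pow_comp, mul_assoc]
    have : h q f g ^ n * x q f g = x q f g * aeval (h q f g) f ^ n :=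
      (SemiconjBy.pow_right (show SemiconjBy (x q f g) _ _ from h_mul_x.symm) n).symm
    rw [this, Algebra.left_comm]

theorem y_mul_aeval_h (p : F[X]) :
    y q f g * aeval (h q f g) p = aeval (h q f g) (p.comp f) * y q f g := by
  induction p using Polynomial.induction_on' with
  | add p r hp hr => simp [add_mul, mul_add, hp, hr]
  | monomial n c =>
    simp only [← C_mul_X_pow_eq_monomial, map_mul, aeval_C, map_pow, aeval_X, mul_comp, C_comp,
      X_pow_comp, mul_assoc]
    have : y q f g * h q f g ^ n = aeval (h q f g) f ^ n * y q f g :=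
      (SemiconjBy.pow_right (show SemiconjBy (y q f g) _ _ from y_mul_h) n)
    rw [Algebra.left_comm, this]

theorem aeval_h_mul_x_pow (p : F[X]) (i : ℕ) :
    aeval (h q f g) p * x q f g ^ i = x q f g ^ i * aeval (h q f g) (p.comp (iter f i)) := by
  induction i with
  | zero => simp [iter]
  | succ i ih =>
    rw [pow_succ, ← mul_assoc, ih, mul_assoc, aeval_h_mul_x, comp_assoc, iter_comp, mul_assoc]

theorem y_pow_mul_aeval_h (p : F[X]) (k : ℕ) :
    y q f g ^ k * aeval (h q f g) p = aeval (h q f g) (p.comp (iter f k)) * y q f g ^ k := by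
  induction k with
  | zero => simp [iter]
  | succ i ih =>
    rw [pow_succ', mul_assoc, ih, ← mul_assoc, y_mul_aeval_h, comp_assoc, iter_comp, mul_assoc]

theorem y_mul_x_pow (i : ℕ) : y q f g * x q f g ^ i =
    q ^ i • (x q f g ^ i * y q f g) + x q f g ^ (i - 1) * aeval (h q f g) (corr q f g i) := by
  induction i with
  | zero => simp [corr]
  | succ i ih =>
    have hs : x q f g * (x q f g ^ (i - 1) * aeval (h q f g) (corr q f g i)) =
        x q f g ^ i * aeval (h q f g) (corr q f g i) := by
      cases i with
      | zero => simp [corr]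
      | succ i => rw [← mul_assoc, ← pow_succ', Nat.add_sub_cancel]
    rw [pow_succ', ← mul_assoc, y_mul_x, add_mul, smul_mul_assoc, mul_assoc, ih, mul_add, hs,
      aeval_h_mul_x_pow, corr, map_add, map_smul, mul_add, Nat.add_sub_cancel, smul_add,
      mul_smul_comm, mul_smul_comm, smul_smul, ← pow_succ', ← mul_assoc, ← pow_succ', add_assoc]

theorem x_mul_mon (i k : ℕ) (p : F[X]) : x q f g * mon q f g i k p = mon q f g (i + 1) k p := by
  simp only [mon_apply, pow_succ', mul_assoc]

theorem aeval_h_mul_mon (u : F[X]) (i k : ℕ) (p : F[X]) :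
    aeval (h q f g) u * mon q f g i k p = mon q f g i k (u.comp (iter f i) * p) := by
  simp only [mon_apply, map_mul, ← mul_assoc, aeval_h_mul_x_pow]

theorem mon_mul_aeval_h (u : F[X]) (i k : ℕ) (p : F[X]) :
    mon q f g i k p * aeval (h q f g) u = mon q f g i k (p * u.comp (iter f k)) := by
  simp only [mon_apply, map_mul, mul_assoc, y_pow_mul_aeval_h]

theorem y_mul_mon (i k : ℕ) (p : F[X]) : y q f g * mon q f g i k p =
    q ^ i • mon q f g i (k + 1) (p.comp f) + mon q f g (i - 1) k (corr q f g i * p) := by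
  simp only [mon_apply, map_mul, ← mul_assoc, y_mul_x_pow, add_mul, smul_mul_assoc]
  rw [mul_assoc (x q f g ^ i), y_mul_aeval_h, pow_succ']
  simp only [mul_assoc]

/-- The operator by which `x` acts on normal forms. -/
noncomputable def opX (F : Type*) [Field F] : Module.End F (ℕ × ℕ →₀ F[X]) :=
  Finsupp.lsum F fun n => Finsupp.lsingle (n.1 + 1, n.2)

/-- The operator by which `h` acts on normal forms. -/
noncomputable def opH (f : F[X]) : Module.End F (ℕ × ℕ →₀ F[X]) :=
  Finsupp.lsum F fun n => Finsupp.lsingle n ∘ₗ LinearMap.mulLeft F (iter f n.1)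

/-- The operator by which `y` acts on normal forms. -/
noncomputable def opY (q : F) (f g : F[X]) : Module.End F (ℕ × ℕ →₀ F[X]) :=
  Finsupp.lsum F fun n =>
    q ^ n.1 • Finsupp.lsingle (n.1, n.2 + 1) ∘ₗ (aeval f).toLinearMap +
      Finsupp.lsingle (n.1 - 1, n.2) ∘ₗ LinearMap.mulLeft F (corr q f g n.1)

theorem opX_single (i k : ℕ) (p : F[X]) :
    opX F (Finsupp.single (i, k) p) = Finsupp.single (i + 1, k) p := by
  simp [opX]

theorem opH_single (i k : ℕ) (p : F[X]) :
    opH f (Finsupp.single (i, k) p) = Finsupp.single (i, k) (iter f i * p) := by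
  simp [opH]

theorem opY_single (i k : ℕ) (p : F[X]) :
    opY q f g (Finsupp.single (i, k) p) = q ^ i • Finsupp.single (i, k + 1) (p.comp f) +
      Finsupp.single (i - 1, k) (corr q f g i * p) := by
  simp [opY, comp_eq_aeval]

theorem aeval_opH_single (u : F[X]) (i k : ℕ) (p : F[X]) :
    aeval (opH f) u (Finsupp.single (i, k) p) =
      Finsupp.single (i, k) (u.comp (iter f i) * p) := by
  induction u using Polynomial.induction_on' generalizing p with
  | add u v hu hv => simp [add_mul, hu, hv]
  | monomial n c =>
    induction n generalizing p with
    | zero => simp [C_mul', Module.algebraMap_end_apply]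
    | succ n ih =>
      rw [← monomial_mul_X, map_mul, aeval_X, Module.End.mul_apply, opH_single, ih, mul_comp,
        X_comp, mul_assoc]

/-- The action of `H_q(f,g)` on normal forms. -/
noncomputable def act (q : F) (f g : F[X]) : QGHA F q f g →ₐ[F] Module.End F (ℕ × ℕ →₀ F[X]) :=
  lift (opX F) (opY q f g) (opH f)
    (by
      refine Finsupp.lhom_ext fun ⟨i, k⟩ p => ?_
      simp only [Module.End.mul_apply, opX_single, opH_single, aeval_opH_single, iter])
    (by
      refine Finsupp.lhom_ext fun ⟨i, k⟩ p => ?_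
      simp only [Module.End.mul_apply, opY_single, opH_single, aeval_opH_single, map_add, map_smul,
        mul_comp, iter_comp]
      cases i with
      | zero => simp only [corr, zero_mul, mul_zero, iter]
      | succ i => simp only [iter, Nat.add_sub_cancel, mul_left_comm])
    (by
      refine Finsupp.lhom_ext fun ⟨i, k⟩ p => ?_
      have : Finsupp.single (i - 1 + 1, k) (corr q f g i * p) =
          Finsupp.single (i, k) (corr q f g i * p) := by
        cases i with
        | zero => simp only [corr, zero_mul, Finsupp.single_zero]
        | succ i => rfl
      simp only [Module.End.mul_apply, LinearMap.add_apply, LinearMap.smul_apply, opY_single,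
        opX_single, aeval_opH_single, corr, add_mul, map_add, smul_add, this, smul_smul,
        pow_succ', add_assoc, Finsupp.single_add, Nat.add_sub_cancel, smul_mul_assoc,
        Finsupp.smul_single])

/-- The coefficients of an element of `H_q(f,g)` with respect to the monomials `mon`. -/
noncomputable def coef (q : F) (f g : F[X]) : QGHA F q f g →ₗ[F] (ℕ × ℕ →₀ F[X]) :=
  LinearMap.applyₗ (Finsupp.single (0, 0) 1) ∘ₗ (act q f g).toLinearMap

/-- The element of `H_q(f,g)` with given normal form. -/
noncomputable def ofCoef (q : F) (f g : F[X]) : (ℕ × ℕ →₀ F[X]) →ₗ[F] QGHA F q f g :=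
  Finsupp.lsum F fun n => mon q f g n.1 n.2

theorem ofCoef_single (i k : ℕ) (p : F[X]) :
    ofCoef q f g (Finsupp.single (i, k) p) = mon q f g i k p := by
  simp [ofCoef]

theorem ofCoef_act (a : QGHA F q f g) (v : ℕ × ℕ →₀ F[X]) :
    ofCoef q f g (act q f g a v) = a * ofCoef q f g v := by
  induction a using induction generalizing v with
  | algebraMap r => simp [Module.algebraMap_end_apply, Algebra.smul_def]
  | mul a b ha hb => rw [map_mul, Module.End.mul_apply, ha, hb, mul_assoc]
  | add a b ha hb => simp [add_mul, ha, hb]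
  | x =>
    induction v using Finsupp.induction_linear with
    | zero => simp
    | add v w hv hw => simp only [map_add, mul_add, hv, hw]
    | single n p =>
      obtain ⟨i, k⟩ := n
      simp [act, opX_single, ofCoef_single, x_mul_mon]
  | y =>
    induction v using Finsupp.induction_linear with
    | zero => simp
    | add v w hv hw => simp only [map_add, mul_add, hv, hw]
    | single n p =>
      obtain ⟨i, k⟩ := n
      simp only [act, lift_y, opY_single, ofCoef_single, y_mul_mon, map_add, map_smul]
  | h =>
    induction v using Finsupp.induction_linear with
    | zero => simp
    | add v w hv hw => simp only [map_add, mul_add, hv, hw]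
    | single n p =>
      obtain ⟨i, k⟩ := n
      have := aeval_h_mul_mon (q := q) (g := g) X i k p (f := f)
      simp only [aeval_X, X_comp] at this
      simp only [act, lift_h, opH_single, ofCoef_single, this]

theorem ofCoef_coef (a : QGHA F q f g) : ofCoef q f g (coef q f g a) = a := by
  simp [coef, ofCoef_act, ofCoef_single, mon_apply]

theorem coef_mon (i k : ℕ) (p : F[X]) :
    coef q f g (mon q f g i k p) = Finsupp.single (i, k) p := by
  have hy : ∀ k, (opY q f g ^ k) (Finsupp.single (0, 0) 1) = Finsupp.single (0, k) 1 := by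
    intro k
    induction k with
    | zero => simp
    | succ k ih => simp [pow_succ', ih, opY_single, corr]
  have hx : ∀ i, (opX F ^ i) (Finsupp.single (0, k) p) = Finsupp.single (i, k) p := by
    intro i
    induction i with
    | zero => simp
    | succ i ih => simp [pow_succ', ih, opX_single]
  simp [coef, mon_apply, ← aeval_algHom_apply]
  simp [act, hy, aeval_opH_single, iter, hx]

theorem sum_mon (a : QGHA F q f g) :
    ∑ n ∈ (coef q f g a).support, mon q f g n.1 n.2 (coef q f g a n) = a := by
  conv_rhs => rw [← ofCoef_coef a]
  simp [ofCoef, Finsupp.sum]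

theorem coef_injective : Function.Injective (coef q f g) :=
  Function.LeftInverse.injective ofCoef_coef

theorem mon_injective (i k : ℕ) : Function.Injective (mon q f g i k) := fun p r hpr => by
  have := congrArg (coef q f g) hpr
  rw [coef_mon, coef_mon] at this
  exact Finsupp.single_injective _ this

theorem aeval_h_eq_mon (p : F[X]) : aeval (h q f g) p = mon q f g 0 0 p := by
  simp [mon_apply]

theorem aeval_h_injective : Function.Injective (aeval (R := F) (h q f g)) := fun p r hpr =>
  mon_injective 0 0 (by rwa [← aeval_h_eq_mon, ← aeval_h_eq_mon])

theorem coef_aeval_h_mul (u : F[X]) (a : QGHA F q f g) (i k : ℕ) :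
    coef q f g (aeval (h q f g) u * a) (i, k) = u.comp (iter f i) * coef q f g a (i, k) := by
  conv_lhs => rw [← sum_mon a]
  simp only [Finset.mul_sum, aeval_h_mul_mon, map_sum, coef_mon, Finsupp.finsetSum_apply,
    Finsupp.single_apply]
  rw [Finset.sum_eq_single (i, k)]
  · simp
  · rintro ⟨i', k'⟩ - hn
    rw [if_neg hn]
  · intro hn
    simp [Finsupp.notMem_support_iff.mp hn]

theorem coef_mul_aeval_h (u : F[X]) (a : QGHA F q f g) (i k : ℕ) :
    coef q f g (a * aeval (h q f g) u) (i, k) = coef q f g a (i, k) * u.comp (iter f k) := by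
  conv_lhs => rw [← sum_mon a]
  simp only [Finset.sum_mul, mon_mul_aeval_h, map_sum, coef_mon, Finsupp.finsetSum_apply,
    Finsupp.single_apply]
  rw [Finset.sum_eq_single (i, k)]
  · simp
  · rintro ⟨i', k'⟩ - hn
    rw [if_neg hn]
  · intro hn
    simp [Finsupp.notMem_support_iff.mp hn]

/-! ### Leading monomials -/

/-- The elements of `H_q(f,g)` all of whose monomials have exponents in `S`. -/
noncomputable def supportedOn (q : F) (f g : F[X]) (S : Set (ℕ × ℕ)) :
    Submodule F (QGHA F q f g) :=
  (Finsupp.supported F[X] F S).comap (coef q f g)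

theorem mem_supportedOn {S : Set (ℕ × ℕ)} {a : QGHA F q f g} :
    a ∈ supportedOn q f g S ↔ ∀ n, coef q f g a n ≠ 0 → n ∈ S := by
  simp [supportedOn, Finsupp.mem_supported, Set.subset_def]

theorem mon_mem_supportedOn {S : Set (ℕ × ℕ)} {i k : ℕ} (hS : (i, k) ∈ S) (p : F[X]) :
    mon q f g i k p ∈ supportedOn q f g S := by
  rw [supportedOn, Submodule.mem_comap, coef_mon]
  exact Finsupp.single_mem_supported F p hS

theorem map_mem_of_mem_supportedOn {S : Set (ℕ × ℕ)} {N : Submodule F (QGHA F q f g)}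
    (T : QGHA F q f g →ₗ[F] QGHA F q f g)
    (hT : ∀ i k, (i, k) ∈ S → ∀ p, T (mon q f g i k p) ∈ N) {a : QGHA F q f g}
    (ha : a ∈ supportedOn q f g S) : T a ∈ N := by
  rw [← sum_mon a, map_sum]
  exact Submodule.sum_mem _ fun n hn =>
    hT _ _ (mem_supportedOn.mp ha _ (Finsupp.mem_support_iff.mp hn)) _

/-- The exponents strictly below `(i, k)` in the lexicographic order. -/
def lexLT (i k : ℕ) : Set (ℕ × ℕ) := {n | n.1 < i ∨ n.1 = i ∧ n.2 < k}

/-- The exponents whose first component is below `i`. -/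
def xLT (i : ℕ) : Set (ℕ × ℕ) := {n | n.1 < i}

theorem mem_xLT {i i' k' : ℕ} : (i', k') ∈ xLT i ↔ i' < i := Iff.rfl

theorem xLT_subset_lexLT (i k : ℕ) : xLT i ⊆ lexLT i k := fun _ hn => Or.inl hn

theorem mem_lexLT {i k i' k' : ℕ} : (i', k') ∈ lexLT i k ↔ i' < i ∨ i' = i ∧ k' < k := Iff.rfl

theorem supportedOn_mono {S T : Set (ℕ × ℕ)} (hST : S ⊆ T) :
    supportedOn q f g S ≤ supportedOn q f g T := fun _ ha =>
  mem_supportedOn.mpr fun n hn => hST (mem_supportedOn.mp ha n hn)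

theorem y_pow_mul_mon_sub_mem (k j l : ℕ) (p : F[X]) :
    y q f g ^ k * mon q f g j l p - q ^ (k * j) • mon q f g j (l + k) (p.comp (iter f k)) ∈
      supportedOn q f g (xLT j) := by
  induction k with
  | zero => simp [iter]
  | succ k ih =>
    have h₁ : y q f g * (y q f g ^ k * mon q f g j l p -
        q ^ (k * j) • mon q f g j (l + k) (p.comp (iter f k))) ∈
        supportedOn q f g (xLT j) := by
      refine map_mem_of_mem_supportedOn (LinearMap.mulLeft F (y q f g)) (fun i' k' hn r => ?_) ih
      rw [LinearMap.mulLeft_apply, y_mul_mon]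
      rw [mem_xLT] at hn
      exact add_mem (Submodule.smul_mem _ _ (mon_mem_supportedOn (by rwa [mem_xLT]) _))
        (mon_mem_supportedOn (by rw [mem_xLT]; omega) _)
    have h₂ : mon q f g (j - 1) (l + k) (corr q f g j * p.comp (iter f k)) ∈
        supportedOn q f g (xLT j) := by
      cases j with
      | zero => simp [corr]
      | succ j => exact mon_mem_supportedOn (by rw [mem_xLT]; omega) _
    rw [mul_sub, mul_smul_comm, y_mul_mon, comp_assoc, iter_comp, ← mul_assoc, ← pow_succ',
      smul_add, smul_smul, ← pow_add, ← Nat.succ_mul, add_assoc l] at h₁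
    have := add_mem h₁ (Submodule.smul_mem _ (q ^ (k * j)) h₂)
    rwa [sub_add_eq_sub_sub, sub_add_cancel] at this

theorem mon_mul_mon_sub_mem (i k j l : ℕ) (p r : F[X]) :
    mon q f g i k p * mon q f g j l r -
        mon q f g (i + j) (l + k) (q ^ (k * j) • (p.comp (iter f j) * r.comp (iter f k))) ∈
      supportedOn q f g (xLT (i + j)) := by
  have hx (i' k' : ℕ) (r : F[X]) : x q f g ^ i * mon q f g i' k' r = mon q f g (i + i') k' r := by
    simp only [mon_apply, ← mul_assoc, pow_add]
  have := map_mem_of_mem_supportedOn (N := supportedOn q f g (xLT (i + j)))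
    (LinearMap.mulLeft F (x q f g ^ i * aeval (h q f g) p))
    (fun i' k' hn r => ?_) (y_pow_mul_mon_sub_mem k j l r)
  · rw [LinearMap.mulLeft_apply, mul_sub, mul_smul_comm, mul_assoc _ _ (mon q f g j (l + k) _),
      aeval_h_mul_mon, hx, ← mul_assoc, ← mon_apply, ← map_smul] at this
    exact this
  · rw [LinearMap.mulLeft_apply, mul_assoc, aeval_h_mul_mon, hx]
    exact mon_mem_supportedOn (by rw [mem_xLT] at hn ⊢; omega) _

theorem mon_mul_mon_mem {i k j l I K : ℕ} (hI : i + j < I ∨ i + j = I ∧ l + k < K) (p r : F[X]) :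
    mon q f g i k p * mon q f g j l r ∈ supportedOn q f g (lexLT I K) := by
  have := mon_mul_mon_sub_mem (q := q) (f := f) (g := g) i k j l p r
  rw [← sub_add_cancel (mon q f g i k p * mon q f g j l r) (mon q f g (i + j) (l + k) _)]
  refine add_mem (supportedOn_mono (fun n hn => ?_) this) (mon_mem_supportedOn hI _)
  rw [mem_xLT] at hn
  rw [mem_lexLT]
  omega

/-- The lexicographically largest monomial of `a` has exponents `(i, k)`. -/
def HasLead (i k : ℕ) (a : QGHA F q f g) : Prop :=
  ∃ p ≠ 0, a - mon q f g i k p ∈ supportedOn q f g (lexLT i k)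

theorem hasLead_mon (i k : ℕ) {p : F[X]} (hp : p ≠ 0) : HasLead i k (mon q f g i k p) :=
  ⟨p, hp, by simp⟩

theorem hasLead_aeval_h {p : F[X]} (hp : p ≠ 0) : HasLead 0 0 (aeval (h q f g) p) :=
  aeval_h_eq_mon (q := q) (f := f) (g := g) p ▸ hasLead_mon 0 0 hp

theorem exists_hasLead {a : QGHA F q f g} (ha : a ≠ 0) : ∃ i k, HasLead i k a := by
  have hne : (coef q f g a).support.Nonempty := by
    rw [Finsupp.support_nonempty_iff, ne_eq, ← (coef q f g).map_zero, coef_injective.eq_iff]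
    exact ha
  obtain ⟨⟨i, k⟩, hn, hmax⟩ := Finset.exists_max_image _ (toLex : ℕ × ℕ → ℕ ×ₗ ℕ) hne
  refine ⟨i, k, _, Finsupp.mem_support_iff.mp hn, mem_supportedOn.mpr ?_⟩
  rintro ⟨i', k'⟩ h'
  rw [map_sub, coef_mon, Finsupp.sub_apply, Finsupp.single_apply] at h'
  have hne : (i, k) ≠ (i', k') := fun h'' => h' (by rw [h'']; simp)
  rw [if_neg hne, sub_zero] at h'
  have := hmax _ (Finsupp.mem_support_iff.mpr h')
  rw [Prod.Lex.toLex_le_toLex] at this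
  rw [mem_lexLT]
  simp only [ne_eq, Prod.mk.injEq] at hne this
  omega

namespace HasLead

variable {i k j l : ℕ} {a b : QGHA F q f g}

theorem coef_ne_zero (ha : HasLead i k a) : coef q f g a (i, k) ≠ 0 := by
  obtain ⟨p, hp, hmem⟩ := ha
  intro h0
  have := mem_supportedOn.mp hmem (i, k) (by simpa [coef_mon, h0] using hp)
  rw [mem_lexLT] at this
  omega

theorem le_of_coef_ne_zero (ha : HasLead i k a) (h' : coef q f g a (j, l) ≠ 0) :
    j < i ∨ j = i ∧ l ≤ k := by
  obtain ⟨p, hp, hmem⟩ := ha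
  by_cases hn : (i, k) = (j, l)
  · simp only [Prod.mk.injEq] at hn
    omega
  have := mem_supportedOn.mp hmem (j, l) (by
    rwa [map_sub, coef_mon, Finsupp.sub_apply, Finsupp.single_apply, if_neg hn, sub_zero])
  rw [mem_lexLT] at this
  omega

theorem unique (ha : HasLead i k a) (ha' : HasLead j l a) : i = j ∧ k = l := by
  have h₁ := ha.le_of_coef_ne_zero ha'.coef_ne_zero
  have h₂ := ha'.le_of_coef_ne_zero ha.coef_ne_zero
  omega

theorem mem_supportedOn_lexLT (ha : HasLead i k a) (hlt : i < j ∨ i = j ∧ k < l) :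
    a ∈ supportedOn q f g (lexLT j l) :=
  mem_supportedOn.mpr fun n hn => by
    have := ha.le_of_coef_ne_zero (j := n.1) (l := n.2) hn
    simp only [lexLT, Set.mem_ofPred_eq]
    omega

theorem add (ha : HasLead i k a) (hb : b ∈ supportedOn q f g (lexLT i k)) :
    HasLead i k (a + b) := by
  obtain ⟨p, hp, hmem⟩ := ha
  exact ⟨p, hp, by rw [add_sub_right_comm]; exact Submodule.add_mem _ hmem hb⟩

theorem smul (ha : HasLead i k a) {c : F} (hc : c ≠ 0) : HasLead i k (c • a) := by
  obtain ⟨p, hp, hmem⟩ := ha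
  exact ⟨c • p, smul_ne_zero hc hp, by
    rw [map_smul, ← smul_sub]; exact Submodule.smul_mem _ _ hmem⟩

end HasLead

theorem natDegree_iter (i : ℕ) : (iter f i).natDegree = f.natDegree ^ i := by
  induction i with
  | zero => simp [iter]
  | succ i ih => rw [iter, natDegree_comp, ih, pow_succ']

theorem comp_ne_zero_of_natDegree {p r : F[X]} (hp : p ≠ 0) (hr : r.natDegree ≠ 0) :
    p.comp r ≠ 0 := by
  intro h0
  rcases comp_eq_zero_iff.mp h0 with h0 | ⟨-, h0⟩
  · exact hp h0
  · exact hr (by rw [h0, natDegree_C])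

theorem HasLead.mul (hq : q ≠ 0) (hf : f.natDegree ≠ 0) {i k j l : ℕ} {a b : QGHA F q f g}
    (ha : HasLead i k a) (hb : HasLead j l b) : HasLead (i + j) (k + l) (a * b) := by
  have hiter (n : ℕ) : (iter f n).natDegree ≠ 0 := by
    rw [natDegree_iter]
    exact pow_ne_zero _ hf
  obtain ⟨p, hp, hpm⟩ := id ha
  obtain ⟨r, hr, hrm⟩ := hb
  refine ⟨q ^ (k * j) • (p.comp (iter f j) * r.comp (iter f k)),
    smul_ne_zero (pow_ne_zero _ hq) (mul_ne_zero (comp_ne_zero_of_natDegree hp (hiter _))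
      (comp_ne_zero_of_natDegree hr (hiter _))), ?_⟩
  have h₁ : (a - mon q f g i k p) * mon q f g j l r ∈
      supportedOn q f g (lexLT (i + j) (k + l)) :=
    map_mem_of_mem_supportedOn (LinearMap.mulRight F (mon q f g j l r)) (fun i' k' hn p' =>
      mon_mul_mon_mem (by rw [mem_lexLT] at hn; omega) _ _) hpm
  have h₂ : a * (b - mon q f g j l r) ∈ supportedOn q f g (lexLT (i + j) (k + l)) := by
    refine map_mem_of_mem_supportedOn (LinearMap.mulLeft F a) (fun j' l' hn r' => ?_) hrm
    refine map_mem_of_mem_supportedOn (S := lexLT i (k + 1))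
      (LinearMap.mulRight F (mon q f g j' l' r')) (fun i' k' hn' p' =>
      mon_mul_mon_mem (by rw [mem_lexLT] at hn hn'; omega) _ _)
      (ha.mem_supportedOn_lexLT (by omega))
  have h₃ := supportedOn_mono (xLT_subset_lexLT _ (k + l))
    (mon_mul_mon_sub_mem (q := q) (f := f) (g := g) i k j l p r)
  rw [add_comm l k] at h₃
  have := add_mem (add_mem h₂ h₁) h₃
  rwa [mul_sub, sub_mul, sub_add_sub_cancel, sub_add_sub_cancel] at this

theorem HasLead.pow (hq : q ≠ 0) (hf : f.natDegree ≠ 0) {i k : ℕ} {a : QGHA F q f g}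
    (ha : HasLead i k a) (n : ℕ) : HasLead (n * i) (n * k) (a ^ n) := by
  induction n with
  | zero => simpa using hasLead_aeval_h (q := q) (f := f) (g := g) one_ne_zero
  | succ n ih =>
    rw [pow_succ, Nat.succ_mul, Nat.succ_mul]
    exact ih.mul hq hf ha

theorem HasLead.aeval (hq : q ≠ 0) (hf : f.natDegree ≠ 0) {i k : ℕ} {a : QGHA F q f g}
    (ha : HasLead i k a) (hik : i ≠ 0 ∨ k ≠ 0) {u : F[X]} (hu : u ≠ 0) :
    HasLead (u.natDegree * i) (u.natDegree * k) (Polynomial.aeval a u) := by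
  rw [aeval_eq_sum_range, Finset.sum_range_succ, add_comm]
  refine ((ha.pow hq hf _).smul (leadingCoeff_ne_zero.mpr hu)).add
    (Submodule.sum_mem _ fun n hn => Submodule.smul_mem _ _ ?_)
  refine (ha.pow hq hf n).mem_supportedOn_lexLT ?_
  rw [Finset.mem_range] at hn
  rcases Nat.eq_zero_or_pos i with rfl | hi
  · exact Or.inr ⟨rfl, Nat.mul_lt_mul_of_pos_right hn (by omega)⟩
  · exact Or.inl (Nat.mul_lt_mul_of_pos_right hn hi)

/-! ### Automorphisms -/

theorem eq_mon_of_coef_ne_zero {i k : ℕ} {a : QGHA F q f g}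
    (ha : ∀ j l, coef q f g a (j, l) ≠ 0 → j = i ∧ l = k) :
    a = mon q f g i k (coef q f g a (i, k)) := by
  refine coef_injective (Finsupp.ext fun ⟨j, l⟩ => ?_)
  rw [coef_mon, Finsupp.single_apply]
  split_ifs with hn
  · rw [hn]
  · by_contra hne
    obtain ⟨rfl, rfl⟩ := ha j l hne
    exact hn rfl

theorem h_ne_zero : h q f g ≠ 0 := fun h0 =>
  X_ne_zero (R := F) (aeval_h_injective (q := q) (f := f) (g := g) (by simp [h0]))

theorem x_eq_mon : x q f g = mon q f g 1 0 1 := by simp [mon_apply]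

theorem y_eq_mon : y q f g = mon q f g 0 1 1 := by simp [mon_apply]

theorem hasLead_x : HasLead 1 0 (x q f g) :=
  x_eq_mon (q := q) (f := f) ▸ hasLead_mon 1 0 one_ne_zero

theorem hasLead_y : HasLead 0 1 (y q f g) :=
  y_eq_mon (q := q) (f := f) ▸ hasLead_mon 0 1 one_ne_zero

theorem HasLead.ne_zero {i k : ℕ} {a : QGHA F q f g} (ha : HasLead i k a) : a ≠ 0 := by
  rintro rfl
  exact ha.coef_ne_zero (by simp)

section

variable (φ : QGHA F q f g ≃ₐ[F] QGHA F q f g)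

theorem map_ne_zero {i k : ℕ} {a : QGHA F q f g} (ha : HasLead i k a) : φ a ≠ 0 :=
  (map_ne_zero_iff φ φ.injective).mpr ha.ne_zero

theorem exists_map_h (hq : q ≠ 0) (hf : 1 < f.natDegree) :
    ∃ P : F[X], φ (h q f g) = aeval (h q f g) P := by
  have hf0 : f.natDegree ≠ 0 := by omega
  obtain ⟨i, k, hK⟩ := exists_hasLead ((map_ne_zero_iff φ φ.injective).mpr h_ne_zero)
  obtain ⟨m, n, hX⟩ := exists_hasLead (map_ne_zero φ hasLead_x)
  have hik : i = 0 ∧ k = 0 := by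
    by_contra hne
    have h₁ := hK.mul hq hf0 hX
    have h₂ := hX.mul hq hf0 (hK.aeval hq hf0 (by omega) (ne_zero_of_natDegree_gt hf))
    rw [← map_mul, h_mul_x, map_mul, ← aeval_algHom_apply] at h₁
    obtain ⟨h₃, h₄⟩ := h₁.unique h₂
    rcases Nat.eq_zero_or_pos i with rfl | hi
    · nlinarith [show 0 < k by omega]
    · nlinarith
  obtain ⟨rfl, rfl⟩ := hik
  refine ⟨_, (eq_mon_of_coef_ne_zero fun i k hne => ?_).trans (aeval_h_eq_mon _).symm⟩
  have := hK.le_of_coef_ne_zero hne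
  omega

theorem map_aeval_h {P : F[X]} (hP : φ (h q f g) = aeval (h q f g) P) (u : F[X]) :
    φ (aeval (h q f g) u) = aeval (h q f g) (u.comp P) := by
  rw [aeval_comp, ← hP, aeval_algHom_apply]

theorem natDegree_eq_one_of_map_h (hq : q ≠ 0) (hf : 1 < f.natDegree) {P : F[X]}
    (hP : φ (h q f g) = aeval (h q f g) P) : P.natDegree = 1 := by
  obtain ⟨P', hP'⟩ := exists_map_h φ.symm hq hf
  have : P'.comp P = X := by
    apply aeval_h_injective (q := q) (f := f) (g := g)
    rw [← map_aeval_h φ hP, ← hP', φ.apply_symm_apply, aeval_X]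
  have := congrArg natDegree this
  rw [natDegree_comp, natDegree_X] at this
  exact (mul_eq_one.mp this).2

theorem eq_succ_of_comp_iter_eq (hf : 1 < f.natDegree) {P : F[X]} (hP : P.natDegree = 1) {i k : ℕ}
    (heq : P.comp (iter f i) = (f.comp P).comp (iter f k)) : i = k + 1 := by
  have := congrArg natDegree heq
  rw [natDegree_comp, natDegree_comp, natDegree_comp, hP, natDegree_iter, natDegree_iter, one_mul,
    mul_one, ← pow_succ'] at this
  exact Nat.pow_right_injective hf this

theorem eq_succ_of_coef_map_x_ne_zero (hq : q ≠ 0) (hf : 1 < f.natDegree) {i k : ℕ}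
    (hik : coef q f g (φ (x q f g)) (i, k) ≠ 0) : i = k + 1 := by
  obtain ⟨P, hP⟩ := exists_map_h φ hq hf
  refine eq_succ_of_comp_iter_eq hf (natDegree_eq_one_of_map_h φ hq hf hP) ?_
  have := congrArg φ (h_mul_x (q := q) (f := f) (g := g))
  rw [map_mul, map_mul, map_aeval_h φ hP, hP] at this
  replace this := congrArg (fun a => coef q f g a (i, k)) this
  simp only [coef_aeval_h_mul, coef_mul_aeval_h] at this
  exact mul_right_cancel₀ hik (this.trans (mul_comm _ _))

theorem eq_succ_of_coef_map_y_ne_zero (hq : q ≠ 0) (hf : 1 < f.natDegree) {i k : ℕ}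
    (hik : coef q f g (φ (y q f g)) (i, k) ≠ 0) : k = i + 1 := by
  obtain ⟨P, hP⟩ := exists_map_h φ hq hf
  refine eq_succ_of_comp_iter_eq hf (natDegree_eq_one_of_map_h φ hq hf hP) ?_
  have := congrArg φ (y_mul_h (q := q) (f := f) (g := g))
  rw [map_mul, map_mul, map_aeval_h φ hP, hP] at this
  replace this := congrArg (fun a => coef q f g a (i, k)) this
  simp only [coef_aeval_h_mul, coef_mul_aeval_h] at this
  exact mul_right_cancel₀ hik ((mul_comm _ _).trans this)

theorem exists_hasLead_map_x (hq : q ≠ 0) (hf : 1 < f.natDegree) :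
    ∃ m, HasLead (m + 1) m (φ (x q f g)) := by
  obtain ⟨i, k, hX⟩ := exists_hasLead (map_ne_zero φ hasLead_x)
  obtain rfl := eq_succ_of_coef_map_x_ne_zero φ hq hf hX.coef_ne_zero
  exact ⟨k, hX⟩

theorem exists_hasLead_map_y (hq : q ≠ 0) (hf : 1 < f.natDegree) :
    ∃ m, HasLead m (m + 1) (φ (y q f g)) := by
  obtain ⟨i, k, hY⟩ := exists_hasLead (map_ne_zero φ hasLead_y)
  obtain rfl := eq_succ_of_coef_map_y_ne_zero φ hq hf hY.coef_ne_zero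
  exact ⟨i, hY⟩

theorem HasLead.map (hq : q ≠ 0) (hf : 1 < f.natDegree) {m l : ℕ}
    (hX : HasLead (m + 1) m (φ (x q f g))) (hY : HasLead l (l + 1) (φ (y q f g)))
    {i k : ℕ} {a : QGHA F q f g} (ha : HasLead i k a)
    (hom : ∀ i' k', coef q f g a (i', k') ≠ 0 → i' + k = i + k') :
    HasLead (i * (m + 1) + k * l) (i * m + k * (l + 1)) (φ a) := by
  obtain ⟨P, hP⟩ := exists_map_h φ hq hf
  have hf0 : f.natDegree ≠ 0 := by omega
  have hP0 : P.natDegree ≠ 0 := by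
    rw [natDegree_eq_one_of_map_h φ hq hf hP]
    exact one_ne_zero
  have hmon (i' k' : ℕ) {p : F[X]} (hp : p ≠ 0) :
      HasLead (i' * (m + 1) + k' * l) (i' * m + k' * (l + 1)) (φ (mon q f g i' k' p)) := by
    rw [mon_apply, map_mul, map_mul, map_pow, map_pow, map_aeval_h φ hP]
    exact (((hX.pow hq hf0 i').mul hq hf0
      (hasLead_aeval_h (comp_ne_zero_of_natDegree hp hP0))).mul hq hf0 (hY.pow hq hf0 k'))
  rw [← sum_mon a, ← Finset.add_sum_erase _ _ (Finsupp.mem_support_iff.mpr ha.coef_ne_zero),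
    map_add, map_sum]
  refine (hmon i k ha.coef_ne_zero).add (Submodule.sum_mem _ fun ⟨i', k'⟩ hn => ?_)
  rw [Finset.mem_erase, Finsupp.mem_support_iff, ne_eq, Prod.mk.injEq] at hn
  refine (hmon i' k' hn.2).mem_supportedOn_lexLT (Or.inl ?_)
  have h₁ := hom i' k' hn.2
  have h₂ := ha.le_of_coef_ne_zero hn.2
  have hi : i' < i := by omega
  have hk : k' ≤ k := by omega
  exact Nat.add_lt_add_of_lt_of_le (Nat.mul_lt_mul_of_pos_right hi (Nat.succ_pos m))
    (Nat.mul_le_mul_right l hk)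

theorem exists_map_x_eq_mon (hq : q ≠ 0) (hf : 1 < f.natDegree) :
    ∃ p : F[X], φ (x q f g) = mon q f g 1 0 p := by
  obtain ⟨m, hX⟩ := exists_hasLead_map_x φ hq hf
  obtain ⟨l, hY⟩ := exists_hasLead_map_y φ hq hf
  obtain ⟨n, hn⟩ := exists_hasLead_map_x φ.symm hq hf
  have hom (i k : ℕ) (hik : coef q f g (φ.symm (x q f g)) (i, k) ≠ 0) : i + n = n + 1 + k := by
    have := eq_succ_of_coef_map_x_ne_zero φ.symm hq hf hik
    omega
  have hlead := HasLead.map φ hq hf hX hY hn hom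
  rw [φ.apply_symm_apply] at hlead
  obtain rfl : m = 0 := by
    have h₁ := (hlead.unique hasLead_x).1
    have h₂ : m + 1 ≤ (n + 1) * (m + 1) := Nat.le_mul_of_pos_left _ n.succ_pos
    omega
  refine ⟨_, eq_mon_of_coef_ne_zero fun i k hik => ?_⟩
  have h₁ := eq_succ_of_coef_map_x_ne_zero φ hq hf hik
  have h₂ := hX.le_of_coef_ne_zero hik
  omega

theorem exists_map_y_eq_mon (hq : q ≠ 0) (hf : 1 < f.natDegree) :
    ∃ p : F[X], φ (y q f g) = mon q f g 0 1 p := by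
  obtain ⟨m, hX⟩ := exists_hasLead_map_x φ hq hf
  obtain ⟨l, hY⟩ := exists_hasLead_map_y φ hq hf
  obtain ⟨n, hn⟩ := exists_hasLead_map_y φ.symm hq hf
  have hom (i k : ℕ) (hik : coef q f g (φ.symm (y q f g)) (i, k) ≠ 0) : i + (n + 1) = n + k := by
    have := eq_succ_of_coef_map_y_ne_zero φ.symm hq hf hik
    omega
  have hlead := HasLead.map φ hq hf hX hY hn hom
  rw [φ.apply_symm_apply] at hlead
  obtain rfl : l = 0 := by
    have h₁ := (hlead.unique hasLead_y).2
    have h₂ : l + 1 ≤ (n + 1) * (l + 1) := Nat.le_mul_of_pos_left _ n.succ_pos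
    omega
  refine ⟨_, eq_mon_of_coef_ne_zero fun i k hik => ?_⟩
  have h₁ := eq_succ_of_coef_map_y_ne_zero φ hq hf hik
  have h₂ := hY.le_of_coef_ne_zero hik
  omega

theorem exists_unit_of_mul_eq_one {p r : F[X]} (hpr : p * r = 1) : ∃ c : Fˣ, p = C (c : F) := by
  obtain ⟨c, hc, rfl⟩ := isUnit_iff.mp (IsUnit.of_mul_eq_one _ hpr)
  exact ⟨hc.unit, rfl⟩

theorem exists_map_x (hq : q ≠ 0) (hf : 1 < f.natDegree) :
    ∃ c : Fˣ, φ (x q f g) = (c : F) • x q f g := by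
  obtain ⟨P, hP⟩ := exists_map_h φ hq hf
  obtain ⟨p, hp⟩ := exists_map_x_eq_mon φ hq hf
  obtain ⟨r, hr⟩ := exists_map_x_eq_mon φ.symm hq hf
  have hpr : p * (r.comp P).comp (iter f 0) = 1 := by
    apply mon_injective (q := q) (f := f) (g := g) 1 0
    have := φ.apply_symm_apply (x q f g)
    rw [hr, mon_apply, map_mul, map_mul, map_aeval_h φ hP, pow_one, hp, pow_zero, map_one,
      mul_one] at this
    rwa [← mon_mul_aeval_h, ← x_eq_mon]
  obtain ⟨c, rfl⟩ := exists_unit_of_mul_eq_one hpr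
  exact ⟨c, by rw [hp, x_eq_mon, ← map_smul, smul_eq_C_mul, mul_one]⟩

theorem exists_map_y (hq : q ≠ 0) (hf : 1 < f.natDegree) :
    ∃ c : Fˣ, φ (y q f g) = (c : F) • y q f g := by
  obtain ⟨P, hP⟩ := exists_map_h φ hq hf
  obtain ⟨p, hp⟩ := exists_map_y_eq_mon φ hq hf
  obtain ⟨r, hr⟩ := exists_map_y_eq_mon φ.symm hq hf
  have hpr : p * (r.comp P).comp (iter f 0) = 1 := by
    rw [mul_comm]
    apply mon_injective (q := q) (f := f) (g := g) 0 1
    have := φ.apply_symm_apply (y q f g)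
    rw [hr, mon_apply, map_mul, map_mul, map_aeval_h φ hP, pow_one, hp, pow_zero, map_one,
      one_mul] at this
    rwa [← aeval_h_mul_mon, ← y_eq_mon]
  obtain ⟨c, rfl⟩ := exists_unit_of_mul_eq_one hpr
  exact ⟨c, by rw [hp, y_eq_mon, ← map_smul, smul_eq_C_mul, mul_one]⟩

end

variable (q f g) in
/-- The endomorphism `x ↦ c x`, `y ↦ c⁻¹ y`, `h ↦ h`. -/
noncomputable def scaleAlgHom (c : Fˣ) : QGHA F q f g →ₐ[F] QGHA F q f g :=
  lift ((c : F) • x q f g) (((c⁻¹ : Fˣ) : F) • y q f g) (h q f g)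
    (by rw [mul_smul_comm, h_mul_x, smul_mul_assoc])
    (by rw [smul_mul_assoc, y_mul_h, mul_smul_comm])
    (by
      rw [smul_mul_smul_comm, smul_mul_smul_comm, Units.inv_mul, Units.mul_inv, one_smul, one_smul,
        y_mul_x])

theorem scaleAlgHom_comp (c d : Fˣ) (hcd : c * d = 1) :
    (scaleAlgHom q f g c).comp (scaleAlgHom q f g d) = AlgHom.id F _ := by
  have hdc : (d : F) * c = 1 := by rw [← Units.val_mul, mul_comm, hcd, Units.val_one]
  have hdc' : ((d⁻¹ : Fˣ) : F) * (c⁻¹ : Fˣ) = 1 := by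
    rw [← Units.val_mul, ← mul_inv_rev, hcd, inv_one, Units.val_one]
  ext a
  induction a using induction with
  | algebraMap r => simp
  | x => simp [scaleAlgHom, smul_smul, hdc]
  | y => simp only [scaleAlgHom, AlgHom.comp_apply, lift_y, map_smul, smul_smul, hdc', one_smul,
      AlgHom.id_apply]
  | h => simp [scaleAlgHom]
  | mul a b ha hb => rw [map_mul, map_mul, ha, hb]
  | add a b ha hb => rw [map_add, map_add, ha, hb]

variable (q f g) in
/-- The automorphism `x ↦ c x`, `y ↦ c⁻¹ y`, `h ↦ h`. -/
noncomputable def scale (c : Fˣ) : QGHA F q f g ≃ₐ[F] QGHA F q f g :=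
  AlgEquiv.ofAlgHom (scaleAlgHom q f g c) (scaleAlgHom q f g c⁻¹)
    (scaleAlgHom_comp _ _ (mul_inv_cancel c)) (scaleAlgHom_comp _ _ (inv_mul_cancel c))

@[simp]
theorem scale_x (c : Fˣ) : scale q f g c (x q f g) = (c : F) • x q f g := by
  simp [scale, scaleAlgHom]

@[simp]
theorem scale_y (c : Fˣ) : scale q f g c (y q f g) = ((c⁻¹ : Fˣ) : F) • y q f g :=
  lift_y ..

@[simp]
theorem scale_h (c : Fˣ) : scale q f g c (h q f g) = h q f g := by
  simp [scale, scaleAlgHom]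

variable (q f g) in
/-- The action of `Fˣ` on `H_q(f,g)` through the automorphisms `scale`. -/
noncomputable def scaleHom : Fˣ →* (QGHA F q f g ≃ₐ[F] QGHA F q f g) :=
  MonoidHom.mk' (scale q f g) fun c d => algEquiv_ext
    (by simp [smul_smul, mul_comm])
    (by simp only [AlgEquiv.mul_apply, scale_y, map_smul, smul_smul, mul_inv_rev, Units.val_mul])
    (by simp)

theorem smul_x_injective : Function.Injective fun c : Fˣ => (c : F) • x q f g := fun _ _ hcd =>
  Units.ext (smul_left_injective F hasLead_x.ne_zero hcd)

theorem scaleHom_injective : Function.Injective (scaleHom q f g) := fun c d hcd =>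
  smul_x_injective (q := q) (f := f) (g := g) (by
    simpa [scaleHom] using DFunLike.congr_fun hcd (x q f g))

theorem map_h_eq_iff (hq : q ≠ 0) (hf : 1 < f.natDegree) (hg : g ≠ 0)
    (φ : QGHA F q f g ≃ₐ[F] QGHA F q f g) :
    φ (h q f g) = h q f g ↔ ∃ c, scaleHom q f g c = φ := by
  refine ⟨fun hh => ?_, ?_⟩
  · obtain ⟨c, hc⟩ := exists_map_x φ hq hf
    obtain ⟨d, hd⟩ := exists_map_y φ hq hf
    have := congrArg φ (y_mul_x (q := q) (f := f) (g := g))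
    rw [map_add, map_smul, map_mul, map_mul, hc, hd, ← aeval_algHom_apply, hh, smul_mul_smul_comm,
      smul_mul_smul_comm, y_mul_x, mul_comm (d : F), smul_comm q, smul_add, add_right_inj] at this
    rw [← map_smul, aeval_h_injective.eq_iff] at this
    have hcd : c * d = 1 := Units.ext (smul_left_injective F hg (by simpa using this))
    refine ⟨c, algEquiv_ext ((scale_x c).trans hc.symm) ((scale_y c).trans ?_)
      ((scale_h c).trans hh.symm)⟩
    rw [hd, inv_eq_of_mul_eq_one_right hcd]
  · rintro ⟨c, rfl⟩
    exact scale_h c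

theorem scaleHom_commute (hq : q ≠ 0) (hf : 1 < f.natDegree) (c : Fˣ)
    (φ : QGHA F q f g ≃ₐ[F] QGHA F q f g) : φ * scaleHom q f g c = scaleHom q f g c * φ := by
  obtain ⟨d, hd⟩ := exists_map_x φ hq hf
  obtain ⟨e, he⟩ := exists_map_y φ hq hf
  obtain ⟨P, hP⟩ := exists_map_h φ hq hf
  refine algEquiv_ext ?_ ?_ ?_
  · change φ (scale q f g c _) = scale q f g c (φ _)
    rw [hd, scale_x, map_smul, map_smul, hd, scale_x, smul_comm]
  · change φ (scale q f g c _) = scale q f g c (φ _)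
    rw [he, scale_y, map_smul, map_smul, he, scale_y, smul_comm]
  · change φ (scale q f g c _) = scale q f g c (φ _)
    rw [hP, scale_h, ← aeval_algHom_apply, scale_h, hP]

end QGHA

/-- Assume `q ≠ 0`, `deg f > 1` and `g ≠ 0`.  Then the subgroup `A` of
`Aut(H_q(f,g))` consisting of the automorphisms fixing `h` is exactly
`{φ_λ : λ ∈ F*}` where `φ_λ(x) = λx`, `φ_λ(y) = λ⁻¹y`, `φ_λ(h) = h`; it is isomorphic to
the multiplicative group `F*` and is central in `Aut(H_q(f,g))`.  Moreover
`Aut(H_q(f,g))` is the internal direct product of `A` and the subgroup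
`B = {φ : φ(x) = x}`: every automorphism factors uniquely as a product of an element of
`A` and an element of `B`. -/
theorem qgha_aut_direct_product {F : Type*} [Field F] (q : F) (f g : F[X])
    (hq : q ≠ 0) (hf : 1 < f.degree) (hg : g ≠ 0) :
    ∃ A B : Subgroup (QGHA F q f g ≃ₐ[F] QGHA F q f g),
      (A : Set (QGHA F q f g ≃ₐ[F] QGHA F q f g)) =
        {φ | φ (QGHA.h q f g) = QGHA.h q f g} ∧
      (B : Set (QGHA F q f g ≃ₐ[F] QGHA F q f g)) =
        {φ | φ (QGHA.x q f g) = QGHA.x q f g} ∧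
      (∀ φ : QGHA F q f g ≃ₐ[F] QGHA F q f g,
        φ ∈ A ↔ ∃ lam : Fˣ,
          φ (QGHA.x q f g) = (lam : F) • QGHA.x q f g ∧
          φ (QGHA.y q f g) = ((lam⁻¹ : Fˣ) : F) • QGHA.y q f g ∧
          φ (QGHA.h q f g) = QGHA.h q f g) ∧
      Nonempty (A ≃* Fˣ) ∧
      A ≤ Subgroup.center (QGHA F q f g ≃ₐ[F] QGHA F q f g) ∧
      (∀ φ : QGHA F q f g ≃ₐ[F] QGHA F q f g,
        ∃! p : A × B, φ = (p.1 : QGHA F q f g ≃ₐ[F] QGHA F q f g) * (p.2 : _)) := by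
  have hf' : 1 < f.natDegree := coe_lt_degree.mp (by exact_mod_cast hf)
  have hA := QGHA.map_h_eq_iff hq hf' hg
  have hrange : (QGHA.scaleHom q f g).range =
      MulAction.stabilizer (QGHA F q f g ≃ₐ[F] QGHA F q f g) (QGHA.h q f g) :=
    Subgroup.ext fun φ => (hA φ).symm
  refine ⟨MulAction.stabilizer _ (QGHA.h q f g), MulAction.stabilizer _ (QGHA.x q f g), rfl, rfl,
    fun φ => ⟨fun hφ => ?_, fun ⟨_, _, _, hφ⟩ => hφ⟩,
    ⟨((MonoidHom.ofInjective QGHA.scaleHom_injective).trans (MulEquiv.subgroupCongr hrange)).symm⟩,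
    fun φ hφ => ?_, fun φ => ?_⟩
  · obtain ⟨c, rfl⟩ := (hA φ).mp hφ
    exact ⟨c, QGHA.scale_x c, QGHA.scale_y c, QGHA.scale_h c⟩
  · obtain ⟨c, rfl⟩ := (hA φ).mp hφ
    exact Subgroup.mem_center_iff.mpr (QGHA.scaleHom_commute hq hf' c)
  · obtain ⟨c, hc⟩ := QGHA.exists_map_x φ hq hf'
    refine ⟨⟨⟨QGHA.scaleHom q f g c, QGHA.scale_h c⟩, ⟨(QGHA.scaleHom q f g c)⁻¹ * φ, ?_⟩⟩,
      (mul_inv_cancel_left _ φ).symm, ?_⟩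
    · rw [MulAction.mem_stabilizer_iff, mul_smul, inv_smul_eq_iff]
      exact hc.trans (QGHA.scale_x c).symm
    · rintro ⟨⟨α, hα⟩, ⟨β, hβ⟩⟩ rfl
      obtain ⟨d, rfl⟩ := (hA α).mp hα
      have hβ' : β (QGHA.x q f g) = QGHA.x q f g := hβ
      have hd : (QGHA.scaleHom q f g d * β) (QGHA.x q f g) = (d : F) • QGHA.x q f g := by
        rw [AlgEquiv.mul_apply, hβ']
        exact QGHA.scale_x d
      obtain rfl : c = d := QGHA.smul_x_injective (hc.symm.trans hd)
      simp
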